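/- Let k be a finite field, let V be a finite index set, and let (d_v)_{v∈V} be a family of positive integers. Then there exists an integer N such that for every prime number q ≥ N and every family (L_v)_{v∈V} of finite field extensions of k with [L_v : k] = d_v · q for each v, there exists a surjective k-algebra homomorphism from the polynomial ring k[t] onto the product k-algebra ∏_{v∈V} L_v. -/

import Mathlib

open Polynomial IntermediateField

lemma num_aux (Q n c : ℕ) (hQ : 2 ≤ Q) (hn : 16 * (c + 1) + 8 ≤ n) :
    n * Q ^ (n/2) + n * c ≤ Q ^ n := by
  set h := n / 2 with hh
  have h1 : (h/2+1)^2 ≤ 2^h := by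
    have a : h/2 < 2^(h/2) := Nat.lt_two_pow_self
    calc (h/2+1)^2 ≤ (2^(h/2))^2 := Nat.pow_le_pow_left a 2
      _ = 2^(h/2*2) := by rw [pow_mul]
      _ ≤ 2^h := Nat.pow_le_pow_right (by norm_num) (by omega)
  have h2 : n * (c+1) ≤ (h/2+1)^2 := by
    have : n ≤ 4 * (h/2+1) := by omega
    have : 4*(c+1) ≤ h/2+1 := by omega
    nlinarith
  have h3 : 2^h ≤ Q^h := Nat.pow_le_pow_left hQ h
  have h4 : Q^h * Q^h ≤ Q^n := by
    rw [← pow_add]; exact Nat.pow_le_pow_right (by omega) (by omega)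
  have h5 : 1 ≤ Q^h := Nat.one_le_pow _ _ (by omega)
  calc n * Q^h + n * c ≤ n * (c+1) * Q^h := by nlinarith [Nat.zero_le (n*c)]
    _ ≤ Q^h * Q^h := Nat.mul_le_mul_right _ (by omega)
    _ ≤ _ := h4

lemma many (k : Type*) [Field k] [Fintype k] (L : Type*) [Field L] [Algebra k L] (n c : ℕ)
    (hn : 16 * (c + 1) + 8 ≤ n) (hL : Module.finrank k L = n) :
    ∃ S : Finset k[X], c ≤ S.card ∧ ∀ f ∈ S, ∃ x : L, minpoly k x = f ∧ k⟮x⟯ = ⊤ := by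
  classical
  have : FiniteDimensional k L := FiniteDimensional.of_finrank_pos (by omega)
  have : Finite L := Module.finite_of_finite k
  have := Fintype.ofFinite L
  set Q := Fintype.card k with hQ
  have hQ2 : 2 ≤ Q := Fintype.one_lt_card
  let G : Finset L := Finset.univ.filter fun x => k⟮x⟯ = ⊤
  let B : Finset L := Finset.univ.filter fun x => ¬ k⟮x⟯ = ⊤
  have hGB : G.card + B.card = Q ^ n := by
    rw [← hL, ← Module.card_eq_pow_finrank (K := k) (V := L), ← Finset.card_univ]
    exact Finset.card_filter_add_card_filter_not _
  have hB : B ⊆ (Finset.range (n/2+1) \ {0}).biUnion fun m => (X ^ Q ^ m - X : L[X]).roots.toFinset := by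
    intro x hx
    have hx : k⟮x⟯ ≠ ⊤ := by simpa [B] using hx
    have hd : Module.finrank k k⟮x⟯ ∣ n := by
      rw [← hL, ← Module.finrank_mul_finrank k k⟮x⟯ L]; exact dvd_mul_right _ _
    have hp : 0 < Module.finrank k k⟮x⟯ := Module.finrank_pos
    have hne : Module.finrank k k⟮x⟯ ≠ n := by
      intro h
      apply hx
      apply IntermediateField.eq_of_le_of_finrank_eq le_top
      rw [h, IntermediateField.finrank_top', hL]
    obtain ⟨e, he⟩ := hd
    have : 2 ≤ e := by
      rcases e with _ | _ | e
      · omega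
      · simp at he; omega
      · omega
    simp only [Finset.mem_biUnion, Finset.mem_sdiff, Finset.mem_range, Finset.mem_singleton]
    refine ⟨Module.finrank k k⟮x⟯, ⟨?_, by omega⟩, ?_⟩
    · have : Module.finrank k k⟮x⟯ * 2 ≤ n := by rw [he]; exact Nat.mul_le_mul_left _ this
      omega
    · rw [Multiset.mem_toFinset, mem_roots (FiniteField.X_pow_card_pow_sub_X_ne_zero L (by omega) (by omega))]
      have : Fintype k⟮x⟯ := Fintype.ofFinite _
      have hc := FiniteField.pow_card (AdjoinSimple.gen k x)
      rw [Module.card_eq_pow_finrank (K := k) (V := k⟮x⟯)] at hc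
      have := congrArg (algebraMap k⟮x⟯ L) hc
      rw [map_pow, AdjoinSimple.algebraMap_gen] at this
      simp [this, hQ]
  have hBc : B.card ≤ n * Q ^ (n/2) := by
    refine (Finset.card_le_card hB).trans ?_
    refine (Finset.card_biUnion_le_card_mul _ _ (Q^(n/2)) ?_).trans ?_
    · intro m hm
      simp only [Finset.mem_sdiff, Finset.mem_range, Finset.mem_singleton] at hm
      refine (Multiset.toFinset_card_le _).trans ((card_roots' _).trans ?_)
      rw [FiniteField.X_pow_card_pow_sub_X_natDegree_eq L hm.2 (by omega)]
      exact Nat.pow_le_pow_right (by omega) (by omega)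
    · apply Nat.mul_le_mul_right
      refine (Finset.card_le_card Finset.sdiff_subset).trans ?_
      simp; omega
  have hG : G.card ≤ n * (G.image (minpoly k)).card := by
    apply Finset.card_le_mul_card_image
    intro f hf
    obtain ⟨x, hx, rfl⟩ := Finset.mem_image.1 hf
    have hne : (minpoly k x).map (algebraMap k L) ≠ 0 :=
      Polynomial.map_ne_zero (minpoly.ne_zero (Algebra.IsIntegral.isIntegral x))
    calc _ ≤ ((minpoly k x).map (algebraMap k L)).roots.toFinset.card := by
          apply Finset.card_le_card
          intro y hy
          have hy := (Finset.mem_filter.1 hy).2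
          rw [Multiset.mem_toFinset, mem_roots hne, IsRoot.def, eval_map_algebraMap, ← hy, minpoly.aeval]
      _ ≤ _ := (Multiset.toFinset_card_le _).trans (card_roots' _)
      _ ≤ n := by rw [natDegree_map, ← hL]; exact minpoly.natDegree_le x
  refine ⟨G.image (minpoly k), ?_, ?_⟩
  · have := num_aux Q n c hQ2 hn
    have : n * c ≤ n * (G.image (minpoly k)).card := by omega
    exact Nat.le_of_mul_le_mul_left this (by omega)
  · intro f hf
    obtain ⟨x, hx, rfl⟩ := Finset.mem_image.1 hf
    exact ⟨x, rfl, by simpa [G] using hx⟩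

/-- Let `k` be a finite field, `V` a finite index set and `(d v)` a family of positive
integers.  Then there is `N` such that for every prime `q ≥ N` and every family
`(L v)` of finite field extensions of `k` with `[L v : k] = d v * q`, there is a
surjective `k`-algebra homomorphism `k[t] → ∏ v, L v`. -/
theorem surjection_from_polynomial_onto_product_of_fields
    (k : Type*) [Field k] [Fintype k] (V : Type*) [Fintype V]
    (d : V → ℕ) (hd : ∀ v, 0 < d v) :
    ∃ N : ℕ, ∀ q : ℕ, N ≤ q → q.Prime →
      ∀ (L : V → Type) [∀ v, Field (L v)] [∀ v, Algebra k (L v)],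
        (∀ v, Module.finrank k (L v) = d v * q) →
        ∃ φ : Polynomial k →ₐ[k] ((v : V) → L v), Function.Surjective φ := by
  classical
  refine ⟨16 * (Fintype.card V + 1) + 8, fun q hq _ L _ _ hL => ?_⟩
  have hn : ∀ v, 16 * (Fintype.card V + 1) + 8 ≤ d v * q := fun v =>
    hq.trans (Nat.le_mul_of_pos_left _ (hd v))
  have hfd : ∀ v, FiniteDimensional k (L v) := fun v =>
    FiniteDimensional.of_finrank_pos (by rw [hL]; have := hn v; omega)
  choose S hS hS' using fun v => many k (L v) _ _ (hn v) (hL v)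
  obtain ⟨f, hfi, hf⟩ := (Finset.all_card_le_biUnion_card_iff_exists_injective S).1 (by
    intro s
    rcases s.eq_empty_or_nonempty with rfl | ⟨v, hv⟩
    · simp
    · exact (Finset.card_le_univ s).trans ((hS v).trans
        (Finset.card_le_card (Finset.subset_biUnion_of_mem S hv))))
  choose x hx hxt using fun v => hS' v (f v) (hf v)
  refine ⟨aeval x, fun y => ?_⟩
  have hsurj : ∀ v, ∃ p : k[X], aeval (x v) p = y v := by
    intro v
    have h1 : Algebra.adjoin k {x v} = ⊤ := by
      rw [← IntermediateField.adjoin_simple_toSubalgebra_of_isAlgebraic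
        (Algebra.IsAlgebraic.isAlgebraic (x v)), hxt, IntermediateField.top_toSubalgebra]
    have : y v ∈ Algebra.adjoin k {x v} := h1 ▸ Algebra.mem_top
    rw [Algebra.adjoin_singleton_eq_range_aeval] at this
    exact this
  choose p hp using hsurj
  have hint : ∀ v, IsIntegral k (x v) := fun v => Algebra.IsIntegral.isIntegral _
  have hcop : Pairwise fun v w => IsCoprime (Ideal.span {f v}) (Ideal.span {f w}) := by
    intro v w hvw
    rw [Ideal.isCoprime_span_singleton_iff, ← hx v, ← hx w]
    rw [(minpoly.irreducible (hint v)).coprime_iff_not_dvd]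
    intro h
    have := eq_of_monic_of_associated (minpoly.monic (hint v)) (minpoly.monic (hint w))
      ((minpoly.irreducible (hint v)).associated_of_dvd (minpoly.irreducible (hint w)) h)
    exact hvw (hfi (by rw [← hx v, ← hx w, this]))
  obtain ⟨P, hP⟩ := Ideal.exists_forall_sub_mem_ideal
    (I := fun v => Ideal.span {f v}) (fun v w h => hcop h) p
  refine ⟨P, funext fun v => ?_⟩
  rw [show aeval x P v = aeval (x v) P from (aeval_algHom_apply (Pi.evalAlgHom k L v) x P).symm]
  obtain ⟨r, hr⟩ := Ideal.mem_span_singleton.1 (hP v)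
  rw [← hp v, ← sub_eq_zero, ← map_sub, hr, map_mul, ← hx v, minpoly.aeval, zero_mul]
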